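/- arXiv:2404.08475 — 3 statements merged into one kernel-verified Lean document; each statement's English description precedes it below -/
import Mathlib

section
/- Fix a Borel-measurable random vector W : Ω → ℝ^N and let 𝒬_W be the family of conditional probability measures ℙ(· | W ∈ ∏_{i=1}^N (a_i, b_i)) taken over all rational endpoints a_i, b_i such that ℙ(W ∈ ∏_{i=1}^N (a_i, b_i)) > 0. Then for bounded random variables X and Y the following are equivalent: (i) (X, W) and (Y, W) have the same joint distribution; (ii) X and Y have the same distribution under every Q ∈ 𝒬_W. Consequently, a map ρ(·, W) : L^∞ → ℝ satisfies 'ρ(X, W) = ρ(Y, W) whenever (X, W) and (Y, W) have the same joint distribution' if and only if it is 𝒬_W-based, i.e., ρ(X, W) = ρ(Y, W) whenever X and Y have the same distribution under every Q ∈ 𝒬_W. Moreover, if W is discrete, 𝒬_W can be chosen as the family {ℙ(· | W = w) : ℙ(W = w) > 0, w ∈ ℝ^N}. -/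
open MeasureTheory ProbabilityTheory Set Filter

noncomputable section

/-- The probability measure `P` is atomless. -/
def Atomless {Ω : Type*} [MeasurableSpace Ω] (P : Measure Ω) : Prop :=
  ∀ A : Set Ω, MeasurableSet A → 0 < P A →
    ∃ B, B ⊆ A ∧ MeasurableSet B ∧ 0 < P B ∧ P B < P A

/-- A bounded (measurable) random variable, i.e. a member of `𝒳 = L^∞`. -/
def BddRV {Ω : Type*} [MeasurableSpace Ω] (X : Ω → ℝ) : Prop :=
  Measurable X ∧ ∃ C : ℝ, ∀ ω, |X ω| ≤ C

/-- Two random variables are comonotonic. -/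
def Comonotonic {Ω : Type*} (X₁ X₂ : Ω → ℝ) : Prop :=
  ∃ (Z : Ω → ℝ) (f₁ f₂ : ℝ → ℝ), Monotone f₁ ∧ Monotone f₂ ∧
    (∀ x, f₁ x + f₂ x = x) ∧ (∀ ω, X₁ ω = f₁ (Z ω)) ∧ (∀ ω, X₂ ω = f₂ (Z ω))

/-- `K` is a Markov-kernel version of the conditional distribution of `X` given `W`. -/
def IsCondDistrib {Ω : Type*} [MeasurableSpace Ω] {N : ℕ} (P : Measure Ω)
    (X : Ω → ℝ) (W : Ω → (Fin N → ℝ)) (K : Kernel (Fin N → ℝ) ℝ) : Prop :=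
  IsMarkovKernel K ∧
    ∀ B : Set ℝ, MeasurableSet B → ∀ S : Set (Fin N → ℝ), MeasurableSet S →
      P ({ω | X ω ∈ B} ∩ W ⁻¹' S) = ∫⁻ w in S, K w B ∂(P.map W)

/-- Membership in `D*`: Borel measurable functions `ℝ^N → [0,1]`. -/
def InDstar {N : ℕ} (f : (Fin N → ℝ) → ℝ) : Prop :=
  Measurable f ∧ ∀ w, f w ∈ Icc (0:ℝ) 1

/-- Equality of conditional laws amounts to equality of unnormalised masses. -/
theorem aux_cond_iff {Ω : Type*} [MeasurableSpace Ω] (P : Measure Ω) [IsProbabilityMeasure P]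
    {X Y : Ω → ℝ} (hX : Measurable X) (hY : Measurable Y) {A : Set Ω} (hA : MeasurableSet A) :
    (0 < P A → (P[|A]).map X = (P[|A]).map Y) ↔
      ∀ B : Set ℝ, MeasurableSet B → P (X ⁻¹' B ∩ A) = P (Y ⁻¹' B ∩ A) := by
  constructor
  · intro h B hB
    rcases eq_or_ne (P A) 0 with h0 | h0
    · rw [measure_mono_null inter_subset_right h0, measure_mono_null inter_subset_right h0]
    · have h1 := congrArg (fun m => m B) (h (pos_iff_ne_zero.mpr h0))
      simp only [Measure.map_apply hX hB, Measure.map_apply hY hB, cond_apply hA] at h1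
      rw [inter_comm, inter_comm _ A]
      exact (ENNReal.mul_right_inj (ENNReal.inv_ne_zero.mpr (measure_ne_top P A))
        (ENNReal.inv_ne_top.mpr h0)).mp h1
  · intro h _
    ext B hB
    rw [Measure.map_apply hX hB, Measure.map_apply hY hB, cond_apply hA, cond_apply hA,
      inter_comm, h B hB, inter_comm]

theorem aux_joint_iff {Ω : Type*} [MeasurableSpace Ω] (P : Measure Ω) [IsProbabilityMeasure P]
    {N : ℕ} {W : Ω → (Fin N → ℝ)} (hW : Measurable W)
    {X Y : Ω → ℝ} (hX : Measurable X) (hY : Measurable Y) :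
    (P.map fun ω => (X ω, W ω)) = (P.map fun ω => (Y ω, W ω)) ↔
      ∀ B : Set ℝ, MeasurableSet B → ∀ S : Set (Fin N → ℝ), MeasurableSet S →
        P (X ⁻¹' B ∩ W ⁻¹' S) = P (Y ⁻¹' B ∩ W ⁻¹' S) := by
  have : IsProbabilityMeasure (P.map fun ω => (X ω, W ω)) :=
    Measure.isProbabilityMeasure_map (hX.prodMk hW).aemeasurable
  rw [Measure.ext_prod_iff]
  constructor
  · intro h B hB S hS
    have := h hB hS
    rwa [Measure.map_apply (hX.prodMk hW) (hB.prod hS),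
      Measure.map_apply (hY.prodMk hW) (hB.prod hS)] at this
  · intro h B S hB hS
    rw [Measure.map_apply (hX.prodMk hW) (hB.prod hS),
      Measure.map_apply (hY.prodMk hW) (hB.prod hS)]
    exact h B hB S hS

theorem aux_box_ext {N : ℕ} (μ ν : Measure (Fin N → ℝ)) [IsFiniteMeasure μ]
    (h : ∀ a b : Fin N → ℚ, μ {w | ∀ i, w i ∈ Ioo (a i : ℝ) (b i : ℝ)} =
      ν {w | ∀ i, w i ∈ Ioo (a i : ℝ) (b i : ℝ)}) : μ = ν := by
  set C : Set (Set ℝ) := ⋃ (a : ℚ) (b : ℚ) (_ : a < b), {Ioo (a : ℝ) (b : ℝ)} with hC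
  have hsp : IsCountablySpanning C :=
    (Real.finiteSpanningSetsInIooRat (volume : Measure ℝ)).isCountablySpanning
  have hgen : MeasurableSpace.generateFrom C = (inferInstance : MeasurableSpace ℝ) := by
    rw [hC, ← Real.borel_eq_generateFrom_Ioo_rat]
    exact (BorelSpace.measurable_eq (α := ℝ)).symm
  have hspan := IsCountablySpanning.pi (fun _ : Fin N => hsp)
  obtain ⟨s, hs, hsu⟩ := hspan
  refine Measure.ext_of_generateFrom_of_iUnion (pi univ '' pi univ fun _ : Fin N => C) s
    (generateFrom_eq_pi (fun _ => hgen) (fun _ => hsp)).symm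
    (IsPiSystem.pi fun _ => Real.isPiSystem_Ioo_rat) hsu hs (fun i => measure_ne_top _ _) ?_
  rintro _ ⟨t, ht, rfl⟩
  have ht' : ∀ i, ∃ a b : ℚ, t i = Ioo (a : ℝ) (b : ℝ) := by
    intro i
    have := ht i (mem_univ i)
    simp only [hC, mem_iUnion, mem_singleton_iff] at this
    obtain ⟨a, b, _, h⟩ := this
    exact ⟨a, b, h⟩
  choose a b hab using ht'
  have : pi univ t = {w | ∀ i, w i ∈ Ioo (a i : ℝ) (b i : ℝ)} := by
    ext w
    simp [hab]
  rw [this]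
  exact h a b

theorem aux_main {Ω : Type*} [MeasurableSpace Ω] (P : Measure Ω) [IsProbabilityMeasure P]
    {N : ℕ} {W : Ω → (Fin N → ℝ)} (hW : Measurable W)
    {X Y : Ω → ℝ} (hX : Measurable X) (hY : Measurable Y) :
    (P.map fun ω => (X ω, W ω)) = (P.map fun ω => (Y ω, W ω)) ↔
        (∀ a b : Fin N → ℚ,
          0 < P {ω | ∀ i, W ω i ∈ Ioo (a i : ℝ) (b i : ℝ)} →
          (P[|{ω | ∀ i, W ω i ∈ Ioo (a i : ℝ) (b i : ℝ)}]).map X =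
            (P[|{ω | ∀ i, W ω i ∈ Ioo (a i : ℝ) (b i : ℝ)}]).map Y) := by
  have hm : ∀ a b : Fin N → ℚ, MeasurableSet {w : Fin N → ℝ | ∀ i, w i ∈ Ioo (a i : ℝ) (b i : ℝ)} :=
    fun a b => by
      have : {w : Fin N → ℝ | ∀ i, w i ∈ Ioo (a i : ℝ) (b i : ℝ)} =
          pi univ fun i => Ioo (a i : ℝ) (b i : ℝ) := by ext w; simp
      rw [this]
      exact MeasurableSet.univ_pi fun i => measurableSet_Ioo
  rw [aux_joint_iff P hW hX hY]
  constructor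
  · intro h a b
    exact (aux_cond_iff P hX hY (hW (hm a b))).mpr fun B hB => h B hB _ (hm a b)
  · intro h B hB S hS
    have key : (P.restrict (X ⁻¹' B)).map W = (P.restrict (Y ⁻¹' B)).map W := by
      apply aux_box_ext
      intro a b
      rw [Measure.map_apply hW (hm a b), Measure.map_apply hW (hm a b),
        Measure.restrict_apply (hW (hm a b)), Measure.restrict_apply (hW (hm a b)),
        inter_comm, inter_comm _ (Y ⁻¹' B)]
      exact (aux_cond_iff P hX hY (hW (hm a b))).mp (h a b) B hB
    have := congrArg (fun m => m S) key
    simp only [Measure.map_apply hW hS, Measure.restrict_apply (hW hS)] at this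
    rwa [inter_comm, inter_comm _ (W ⁻¹' S)]

theorem aux_discrete {Ω : Type*} [MeasurableSpace Ω] (P : Measure Ω) [IsProbabilityMeasure P]
    {N : ℕ} {W : Ω → (Fin N → ℝ)} (hW : Measurable W) (hc : (Set.range W).Countable)
    {X Y : Ω → ℝ} (hX : Measurable X) (hY : Measurable Y) :
    (P.map fun ω => (X ω, W ω)) = (P.map fun ω => (Y ω, W ω)) ↔
        (∀ w : Fin N → ℝ, 0 < P (W ⁻¹' {w}) →
              (P[|W ⁻¹' {w}]).map X = (P[|W ⁻¹' {w}]).map Y) := by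
  rw [aux_joint_iff P hW hX hY]
  constructor
  · intro h w
    exact (aux_cond_iff P hX hY (hW (measurableSet_singleton w))).mpr
      fun B hB => h B hB _ (measurableSet_singleton w)
  · intro h B hB S hS
    have hc' : (S ∩ range W).Countable := hc.mono inter_subset_right
    have dec : ∀ Z : Ω → ℝ, Measurable Z → P (Z ⁻¹' B ∩ W ⁻¹' S) =
        ∑' w : ↥(S ∩ range W), P (Z ⁻¹' B ∩ W ⁻¹' {(w : Fin N → ℝ)}) := by
      intro Z hZ
      rw [← measure_biUnion (f := fun w => Z ⁻¹' B ∩ W ⁻¹' {w}) hc']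
      · congr 1
        ext ω
        simp only [mem_inter_iff, mem_preimage, mem_iUnion, mem_singleton_iff, mem_range,
          exists_prop]
        constructor
        · rintro ⟨h1, h2⟩
          exact ⟨W ω, ⟨h2, ω, rfl⟩, h1, rfl⟩
        · rintro ⟨w, ⟨h2, _⟩, h1, h3⟩
          exact ⟨h1, h3 ▸ h2⟩
      · intro u _ v _ huv
        refine Set.disjoint_left.mpr ?_
        rintro ω ⟨_, h1⟩ ⟨_, h2⟩
        exact huv (h1.symm.trans h2)
      · intro w _
        exact (hZ hB).inter (hW (measurableSet_singleton w))
    rw [dec X hX, dec Y hY]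
    exact tsum_congr fun w =>
      (aux_cond_iff P hX hY (hW (measurableSet_singleton _))).mp (h w) B hB

/-- **Proposition (law-invariance vs `𝒬_W`-based).** For a fixed factor `W`:
(i) ⇔ (ii) for bounded random variables; consequently `ρ(·, W)` is law-invariant in the
joint-distribution sense iff it is `𝒬_W`-based, where `𝒬_W` consists of the conditional
probabilities on rational boxes of positive probability; and if `W` is discrete one may
use the family `{P(· | W = w) : P(W = w) > 0}` instead. -/
theorem stmt0 {Ω : Type*} [MeasurableSpace Ω] (P : Measure Ω) [IsProbabilityMeasure P]
    (hatomless : Atomless P) {N : ℕ} (hN : 1 ≤ N)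
    (W : Ω → (Fin N → ℝ)) (hW : Measurable W) :
    -- (i) ⇔ (ii)
    (∀ X Y : Ω → ℝ, BddRV X → BddRV Y →
      ((P.map fun ω => (X ω, W ω)) = (P.map fun ω => (Y ω, W ω)) ↔
        (∀ a b : Fin N → ℚ,
          0 < P {ω | ∀ i, W ω i ∈ Ioo (a i : ℝ) (b i : ℝ)} →
          (P[|{ω | ∀ i, W ω i ∈ Ioo (a i : ℝ) (b i : ℝ)}]).map X =
            (P[|{ω | ∀ i, W ω i ∈ Ioo (a i : ℝ) (b i : ℝ)}]).map Y))) ∧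
    -- consequence: law-invariance of `ρ(·, W)` ⇔ `𝒬_W`-based
    (∀ ρ : (Ω → ℝ) → ℝ,
      ((∀ X Y : Ω → ℝ, BddRV X → BddRV Y →
          (P.map fun ω => (X ω, W ω)) = (P.map fun ω => (Y ω, W ω)) → ρ X = ρ Y) ↔
        (∀ X Y : Ω → ℝ, BddRV X → BddRV Y →
          (∀ a b : Fin N → ℚ,
            0 < P {ω | ∀ i, W ω i ∈ Ioo (a i : ℝ) (b i : ℝ)} →
            (P[|{ω | ∀ i, W ω i ∈ Ioo (a i : ℝ) (b i : ℝ)}]).map X =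
              (P[|{ω | ∀ i, W ω i ∈ Ioo (a i : ℝ) (b i : ℝ)}]).map Y) → ρ X = ρ Y))) ∧
    -- discrete case
    ((Set.range W).Countable →
      ∀ ρ : (Ω → ℝ) → ℝ,
        ((∀ X Y : Ω → ℝ, BddRV X → BddRV Y →
            (P.map fun ω => (X ω, W ω)) = (P.map fun ω => (Y ω, W ω)) → ρ X = ρ Y) ↔
          (∀ X Y : Ω → ℝ, BddRV X → BddRV Y →
            (∀ w : Fin N → ℝ, 0 < P (W ⁻¹' {w}) →
              (P[|W ⁻¹' {w}]).map X = (P[|W ⁻¹' {w}]).map Y) → ρ X = ρ Y))) := by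
  refine ⟨fun X Y hX hY => aux_main P hW hX.1 hY.1, fun ρ => ?_, fun hc ρ => ?_⟩
  · exact ⟨fun h X Y hX hY hh => h X Y hX hY ((aux_main P hW hX.1 hY.1).mpr hh),
      fun h X Y hX hY hh => h X Y hX hY ((aux_main P hW hX.1 hY.1).mp hh)⟩
  · exact ⟨fun h X Y hX hY hh => h X Y hX hY ((aux_discrete P hW hc hX.1 hY.1).mpr hh),
      fun h X Y hX hY hh => h X Y hX hY ((aux_discrete P hW hc hX.1 hY.1).mp hh)⟩
end
end

section
/- A mapping ρ : 𝒳 × 𝒴 → ℝ satisfies conditions M, CA, N and LI if and only if there exists a law-invariant family of monotone functionals {G_W : W ∈ 𝒴} such that ρ(X, W) = ∫₀^∞ G_W(1 − F_{X|W=·}(x)) dx + ∫_{−∞}^0 (G_W(1 − F_{X|W=·}(x)) − 1) dx for all X ∈ 𝒳 and W ∈ 𝒴. -/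
open MeasureTheory ProbabilityTheory Set Filter

noncomputable section

/-- A monotone distortion functional on `D*` (monotone w.r.t. the `μ`-a.e. order). -/
def MonotoneFunctional {N : ℕ} (μ : Measure (Fin N → ℝ))
    (G : ((Fin N → ℝ) → ℝ) → ℝ) : Prop :=
  (∀ f, InDstar f → G f ∈ Icc (0:ℝ) 1) ∧
  G (fun _ => 0) = 0 ∧ G (fun _ => 1) = 1 ∧
  ∀ f g, InDstar f → InDstar g → (∀ᵐ w ∂μ, g w ≤ f w) → G g ≤ G f

/-- The distortion factor risk measure value
`∫₀^∞ G(1 − F_{X|W=·}(x)) dx + ∫_{−∞}^0 (G(1 − F_{X|W=·}(x)) − 1) dx`,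
where `F_{X|W=w}(x) = K((−∞,x], w)`. -/
def distortionRM {N : ℕ} (G : ((Fin N → ℝ) → ℝ) → ℝ) (K : Kernel (Fin N → ℝ) ℝ) : ℝ :=
  (∫ x in Ioi (0:ℝ), G (fun w => 1 - (K w (Iic x)).toReal)) +
  (∫ x in Iio (0:ℝ), ((G (fun w => 1 - (K w (Iic x)).toReal)) - 1))


lemma atomless_small_sub {Ω : Type*} [MeasurableSpace Ω] {P : Measure Ω} [IsProbabilityMeasure P]
    (h : Atomless P) (A : Set Ω) (hA : MeasurableSet A) (hpos : 0 < P A) (n : ℕ) :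
    ∃ B, B ⊆ A ∧ MeasurableSet B ∧ 0 < P B ∧ P B ≤ (2⁻¹ : ENNReal) ^ n := by
  induction n with
  | zero => exact ⟨A, subset_rfl, hA, hpos, by simpa using prob_le_one⟩
  | succ n ih =>
    obtain ⟨B, hBA, hB, hB0, hBn⟩ := ih
    obtain ⟨C, hCB, hC, hC0, hCB'⟩ := h B hB hB0
    have hsum : P C + P (B \ C) = P B := by
      rw [← measure_union disjoint_sdiff_right (hB.diff hC), union_sdiff_cancel hCB]
    have hD0 : 0 < P (B \ C) := by
      rw [pos_iff_ne_zero]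
      intro h0
      rw [h0, add_zero] at hsum
      exact hCB'.ne hsum
    have key : ∀ a b c : ENNReal, a + b = c → a ≤ b → c ≤ (2⁻¹ : ENNReal) ^ n →
        a ≤ (2⁻¹ : ENNReal) ^ (n+1) := by
      intro a b c h1 h2 h3
      rw [pow_succ, ← div_eq_mul_inv, ENNReal.le_div_iff_mul_le (by simp) (by simp), mul_two]
      calc a + a ≤ a + b := by gcongr
        _ = c := h1
        _ ≤ _ := h3
    rcases le_total (P C) (P (B \ C)) with hle | hle
    · exact ⟨C, hCB.trans hBA, hC, hC0, key _ _ _ hsum hle hBn⟩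
    · exact ⟨B \ C, sdiff_subset.trans hBA, hB.diff hC, hD0,
        key _ _ _ ((add_comm _ _).trans hsum) hle hBn⟩

lemma small_cover {Ω : Type*} [MeasurableSpace Ω] {P : Measure Ω} [IsProbabilityMeasure P]
    (h : Atomless P) (n : ℕ) :
    ∃ c : Set (Set Ω), c.Countable ∧ (∀ B ∈ c, MeasurableSet B ∧ P B ≤ (2⁻¹ : ENNReal) ^ n) ∧
      ⋃₀ c = univ := by
  let T : Set ENNReal := {x | ∃ c : Set (Set Ω), c.Countable ∧
    (∀ B ∈ c, MeasurableSet B ∧ P B ≤ (2⁻¹ : ENNReal) ^ n) ∧ x = P (⋃₀ c)}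
  have hT : T.Nonempty := ⟨P (⋃₀ ∅), ∅, countable_empty, by simp, rfl⟩
  obtain ⟨u, -, hu, huT⟩ := exists_seq_tendsto_sSup hT (OrderTop.bddAbove T)
  choose c hc hc' hc'' using huT
  have hD : (⋃ m, c m).Countable := countable_iUnion hc
  have hD' : ∀ B ∈ ⋃ m, c m, MeasurableSet B ∧ P B ≤ (2⁻¹ : ENNReal) ^ n := by
    intro B hB
    obtain ⟨m, hm⟩ := mem_iUnion.1 hB
    exact hc' m B hm
  have hmeas : MeasurableSet (⋃₀ ⋃ m, c m) :=
    MeasurableSet.sUnion hD (fun B hB => (hD' B hB).1)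
  have hge : sSup T ≤ P (⋃₀ ⋃ m, c m) := by
    refine le_of_tendsto' hu (fun m => ?_)
    rw [hc'' m]
    exact measure_mono (sUnion_subset_sUnion (subset_iUnion c m))
  have hnull : P (⋃₀ ⋃ m, c m)ᶜ = 0 := by
    by_contra hne
    obtain ⟨B, hBs, hB, hB0, hBn⟩ := atomless_small_sub h _ hmeas.compl (pos_iff_ne_zero.2 hne) n
    have hmem : P (⋃₀ insert B (⋃ m, c m)) ∈ T := by
      refine ⟨_, hD.insert B, ?_, rfl⟩
      intro B' hB'
      rcases hB' with rfl | hB'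
      · exact ⟨hB, hBn⟩
      · exact hD' _ hB'
    have h1 := (le_sSup hmem).trans hge
    rw [sUnion_insert, measure_union (disjoint_compl_left.mono_left hBs) hmeas] at h1
    have h2 := ENNReal.lt_add_right (measure_ne_top P (⋃₀ ⋃ m, c m)) hB0.ne'
    rw [add_comm] at h2
    exact absurd h1 (not_le.2 h2)
  refine ⟨insert (⋃₀ ⋃ m, c m)ᶜ (⋃ m, c m), hD.insert _, ?_, ?_⟩
  · intro B' hB'
    rcases hB' with rfl | hB'
    · exact ⟨hmeas.compl, by rw [hnull]; exact zero_le⟩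
    · exact hD' _ hB'
  · rw [sUnion_insert, compl_union_self]

lemma exists_noatom {Ω : Type*} [MeasurableSpace Ω] {P : Measure Ω} [IsProbabilityMeasure P]
    (h : Atomless P) : ∃ V : Ω → ℝ, Measurable V ∧ ∀ x, P (V ⁻¹' {x}) = 0 := by
  choose c hc hc' hc'' using small_cover h
  let D : Set (Set Ω) := ⋃ n, c n
  have hD : D.Countable := countable_iUnion hc
  have : Countable D := hD.to_subtype
  let V0 : Ω → (D → ℝ) := fun ω B => (B : Set Ω).indicator (fun _ => (1:ℝ)) ω
  have hV0 : Measurable V0 := by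
    refine measurable_pi_lambda _ (fun B => ?_)
    obtain ⟨n, hn⟩ := mem_iUnion.1 B.2
    exact measurable_const.indicator (hc' n _ hn).1
  have he := measurableEmbedding_embeddingReal (D → ℝ)
  refine ⟨embeddingReal (D → ℝ) ∘ V0, he.measurable.comp hV0, fun x => ?_⟩
  have hle : ∀ n : ℕ, P ((embeddingReal (D → ℝ) ∘ V0) ⁻¹' {x}) ≤ (2⁻¹ : ENNReal) ^ n := by
    intro n
    rcases eq_empty_or_nonempty ((embeddingReal (D → ℝ) ∘ V0) ⁻¹' {x}) with h0 | ⟨ω0, h0⟩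
    · rw [h0]; simp
    · have : ω0 ∈ ⋃₀ c n := by rw [hc'']; trivial
      obtain ⟨B, hB, hω⟩ := this
      refine le_trans (measure_mono ?_) (hc' n B hB).2
      intro ω hω'
      have heq : V0 ω = V0 ω0 := he.injective (by
        have h1 : _ = x := hω'
        have h2 : _ = x := h0
        exact h1.trans h2.symm)
      have := congrFun heq ⟨B, mem_iUnion.2 ⟨n, hB⟩⟩
      by_contra hn
      simp [V0, hω, hn] at this
  have ht : Tendsto (fun n : ℕ => (2⁻¹ : ENNReal) ^ n) atTop (nhds 0) :=
    ENNReal.tendsto_pow_atTop_nhds_zero_of_lt_one (by simp)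
  exact le_antisymm (ge_of_tendsto' ht hle) zero_le

lemma exists_unif {Ω : Type*} [MeasurableSpace Ω] {P : Measure Ω} [IsProbabilityMeasure P]
    (h : Atomless P) : ∃ U : Ω → unitInterval, Measurable U ∧ P.map U = volume := by
  obtain ⟨V, hV, hV0⟩ := exists_noatom h
  let κ := P.map V
  have : IsProbabilityMeasure κ := Measure.isProbabilityMeasure_map hV.aemeasurable
  have hκ : ∀ x, κ {x} = 0 := fun x => by
    rw [Measure.map_apply hV (measurableSet_singleton x)]; exact hV0 x
  have hcont : Continuous (cdf κ) := by
    rw [continuous_iff_continuousAt]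
    intro x
    rw [(monotone_cdf κ).continuousAt_iff_leftLim_eq_rightLim, StieltjesFunction.rightLim_eq]
    have h1 := StieltjesFunction.measure_singleton (cdf κ) x
    rw [measure_cdf, hκ x] at h1
    have h2 := (monotone_cdf κ).leftLim_le (le_refl x)
    have h3 := ENNReal.ofReal_eq_zero.1 h1.symm
    linarith
  let U : Ω → unitInterval := fun ω => ⟨cdf κ (V ω), cdf_nonneg κ _, cdf_le_one κ _⟩
  have hU : Measurable U := ((monotone_cdf κ).measurable.comp hV).subtype_mk
  have : IsProbabilityMeasure (P.map U) := Measure.isProbabilityMeasure_map hU.aemeasurable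
  refine ⟨U, hU, ?_⟩
  have hivt : ∀ t : ℝ, 0 < t → t < 1 → ∃ x, cdf κ x = t := by
    intro t h0 h1
    obtain ⟨a, ha⟩ := ((tendsto_cdf_atBot κ).eventually (gt_mem_nhds h0)).exists
    obtain ⟨b, hb⟩ := ((tendsto_cdf_atTop κ).eventually (lt_mem_nhds h1)).exists
    obtain ⟨x, hx⟩ := mem_range_of_exists_le_of_exists_ge hcont ⟨a, ha.le⟩ ⟨b, hb.le⟩
    exact ⟨x, hx⟩
  have hIic : ∀ x, P {ω | V ω ≤ x} = ENNReal.ofReal (cdf κ x) := by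
    intro x
    rw [ofReal_cdf, Measure.map_apply hV measurableSet_Iic]; rfl
  refine Measure.ext_of_Iic _ _ (fun t => ?_)
  rw [Measure.map_apply hU measurableSet_Iic, unitInterval.volume_Iic]
  have hset : U ⁻¹' Iic t = {ω | cdf κ (V ω) ≤ t} := by
    ext ω; simp [U, ← Subtype.coe_le_coe]
  rw [hset]
  apply le_antisymm
  · rcases eq_or_lt_of_le t.2.2 with h1 | h1
    · rw [h1]; simpa using prob_le_one
    · have : ∀ s ∈ Ioo (t:ℝ) 1, P {ω | cdf κ (V ω) ≤ t} ≤ ENNReal.ofReal s := by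
        intro s hs
        obtain ⟨x, hx⟩ := hivt s (t.2.1.trans_lt hs.1) hs.2
        rw [← hx, ← hIic]
        refine measure_mono (fun ω hω => ?_)
        by_contra hn
        have h3 := monotone_cdf κ (not_le.1 hn).le
        have : cdf κ (V ω) ≤ t := hω
        linarith [hs.1]
      have hlim : Tendsto (fun s : ℝ => ENNReal.ofReal s) (nhdsWithin (t:ℝ) (Ioi t))
          (nhds (ENNReal.ofReal t)) :=
        (ENNReal.continuous_ofReal.tendsto _).mono_left nhdsWithin_le_nhds
      refine ge_of_tendsto hlim ?_
      filter_upwards [Ioo_mem_nhdsGT h1] with s hs using this s hs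
  · rcases eq_or_lt_of_le t.2.1 with h0 | h0
    · rw [← h0]; simp
    rcases eq_or_lt_of_le t.2.2 with h1 | h1
    · have : {ω | cdf κ (V ω) ≤ t} = univ := by
        ext ω; simp [h1, cdf_le_one]
      rw [this, h1]; simp
    · obtain ⟨x, hx⟩ := hivt t h0 h1
      rw [← hx, ← hIic]
      refine measure_mono (fun ω hω => ?_)
      exact monotone_cdf κ hω

lemma integral_of_incr (ψ F : ℝ → ℝ) (hψ : Antitone ψ) (a b : ℝ) (hab : a ≤ b)
    (h : ∀ s t, a ≤ s → s ≤ t → t ≤ b →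
      (t - s) * ψ t ≤ F t - F s ∧ F t - F s ≤ (t - s) * ψ s) :
    F b - F a = ∫ x in a..b, ψ x := by
  have hint : ∀ s t, IntervalIntegrable ψ volume s t := fun s t => hψ.intervalIntegrable
  let D : ℝ → ℝ := fun t => F t - ∫ x in a..t, ψ x
  have hD : ∀ s t, a ≤ s → s ≤ t → t ≤ b → |D t - D s| ≤ (t - s) * (ψ s - ψ t) := by
    intro s t h1 h2 h3
    have hI : (∫ x in a..t, ψ x) - ∫ x in a..s, ψ x = ∫ x in s..t, ψ x :=
      intervalIntegral.integral_interval_sub_left (hint _ _) (hint _ _)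
    have hlo : (t - s) * ψ t ≤ ∫ x in s..t, ψ x := by
      have := intervalIntegral.integral_mono_on h2 (f := fun _ => ψ t) (g := ψ)
        intervalIntegrable_const (hint s t) (fun x hx => hψ hx.2)
      simpa using this
    have hhi : ∫ x in s..t, ψ x ≤ (t - s) * ψ s := by
      have := intervalIntegral.integral_mono_on h2 (g := fun _ => ψ s) (f := ψ)
        (hint s t) intervalIntegrable_const (fun x hx => hψ hx.1)
      simpa using this
    obtain ⟨h4, h5⟩ := h s t h1 h2 h3
    have : D t - D s = (F t - F s) - ∫ x in s..t, ψ x := by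
      simp only [D]; rw [← hI]; ring
    rw [this, abs_le]
    constructor <;> nlinarith
  have hbound : ∀ n : ℕ, |D b - D a| ≤ ((b - a) * (ψ a - ψ b)) / ((n:ℝ) + 1) := by
    intro n
    have hn : (0:ℝ) < (n:ℝ) + 1 := by positivity
    let p : ℕ → ℝ := fun k => a + k * ((b - a) / ((n:ℝ) + 1))
    have hd : 0 ≤ (b - a) / ((n:ℝ) + 1) := div_nonneg (by linarith) hn.le
    have hp1 : p (n+1) = b := by
      simp only [p]; push_cast; field_simp; ring
    have hp0 : p 0 = a := by simp [p]
    have hstep : ∀ k, p (k+1) - p k = (b - a) / ((n:ℝ) + 1) := by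
      intro k; simp only [p]; push_cast; ring
    have hmono : Monotone p := monotone_nat_of_le_succ (fun k => by linarith [hstep k])
    have hind : ∀ k, k ≤ n + 1 → |D (p k) - D (p 0)| ≤
        (b - a) / ((n:ℝ) + 1) * (ψ (p 0) - ψ (p k)) := by
      intro k
      induction k with
      | zero => intro _; simp
      | succ k ih =>
        intro hk
        have h1 := ih (by omega)
        have h2 := hD (p k) (p (k+1)) (by rw [← hp0]; exact hmono (Nat.zero_le _))
          (hmono (Nat.le_succ _)) (by rw [← hp1]; exact hmono hk)
        rw [hstep] at h2
        have h3 := abs_add_le (D (p (k+1)) - D (p k)) (D (p k) - D (p 0))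
        rw [sub_add_sub_cancel] at h3
        nlinarith
    have := hind (n+1) le_rfl
    rw [hp0, hp1] at this
    rw [mul_div_right_comm]
    exact this
  have hlim : Tendsto (fun n : ℕ => ((b - a) * (ψ a - ψ b)) / ((n:ℝ) + 1)) atTop (nhds 0) := by
    have := (tendsto_one_div_add_atTop_nhds_zero_nat (𝕜 := ℝ)).const_mul ((b - a) * (ψ a - ψ b))
    simpa [div_eq_mul_inv] using this
  have h0 : |D b - D a| ≤ 0 := ge_of_tendsto' hlim hbound
  have h1 : D b - D a = 0 := abs_nonpos_iff.1 h0
  simp only [D, intervalIntegral.integral_same] at h1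
  linarith

lemma choquet_rep (ψ : ℝ → ℝ) (hψ : Antitone ψ) (u v : ℝ) (_huv : u ≤ v)
    (h1 : ∀ x, x < u → ψ x = 1) (h0 : ∀ x, v ≤ x → ψ x = 0) :
    (∫ x in Ioi (0:ℝ), ψ x) + (∫ x in Iio (0:ℝ), (ψ x - 1)) = u + ∫ x in u..v, ψ x := by
  have hint : ∀ s t, IntervalIntegrable ψ volume s t := fun s t => hψ.intervalIntegrable
  have hm : min u 0 ≤ 0 := min_le_right _ _
  have hmu : min u 0 ≤ u := min_le_left _ _
  have hM : 0 ≤ max v 0 := le_max_right _ _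
  have hMv : v ≤ max v 0 := le_max_left _ _
  have e1 : ∫ x in Ioi (0:ℝ), ψ x = ∫ x in (0:ℝ)..(max v 0), ψ x := by
    rw [intervalIntegral.integral_of_le hM]
    refine setIntegral_eq_of_subset_of_forall_sdiff_eq_zero measurableSet_Ioi
      Ioc_subset_Ioi_self ?_ |>.symm |>.symm
    intro x hx
    apply h0
    have h2 : ¬ x ≤ max v 0 := fun h => hx.2 ⟨hx.1, h⟩
    linarith
  have e2 : ∫ x in Iio (0:ℝ), (ψ x - 1) = ∫ x in (min u 0)..(0:ℝ), (ψ x - 1) := by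
    rw [intervalIntegral.integral_of_le hm, integral_Ioc_eq_integral_Ioo,
      ← integral_Ico_eq_integral_Ioo]
    refine setIntegral_eq_of_subset_of_forall_sdiff_eq_zero measurableSet_Iio
      Ico_subset_Iio_self ?_
    intro x hx
    have h2 : ¬ min u 0 ≤ x := fun h => hx.2 ⟨h, hx.1⟩
    rw [h1 x (by linarith), sub_self]
  have e3 : ∫ x in (min u 0)..(0:ℝ), (ψ x - 1) = (∫ x in (min u 0)..(0:ℝ), ψ x) + min u 0 := by
    rw [intervalIntegral.integral_sub (hint _ _) intervalIntegrable_const]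
    simp
  have e4 : ∫ x in (min u 0)..u, ψ x = u - min u 0 := by
    have : ∫ x in (min u 0)..u, ψ x = ∫ x in (min u 0)..u, (1:ℝ) := by
      rw [intervalIntegral.integral_of_le hmu, intervalIntegral.integral_of_le hmu,
        integral_Ioc_eq_integral_Ioo, integral_Ioc_eq_integral_Ioo]
      exact setIntegral_congr_fun measurableSet_Ioo (fun x hx => h1 x hx.2)
    rw [this]; simp
  have e5 : ∫ x in v..(max v 0), ψ x = 0 := by
    rw [intervalIntegral.integral_of_le hMv]
    exact setIntegral_eq_zero_of_forall_eq_zero (fun x hx => h0 x hx.1.le)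
  have a1 := intervalIntegral.integral_add_adjacent_intervals (hint (min u 0) 0) (hint 0 (max v 0))
  have a2 := intervalIntegral.integral_add_adjacent_intervals (hint (min u 0) u) (hint u (max v 0))
  have a3 := intervalIntegral.integral_add_adjacent_intervals (hint u v) (hint v (max v 0))
  rw [e1, e2, e3]
  linarith

lemma additive_mono_linear (h : ℝ → ℝ) (hadd : ∀ a b, 0 ≤ a → 0 ≤ b → h (a + b) = h a + h b)
    (hmono : ∀ a b, 0 ≤ a → a ≤ b → h a ≤ h b) (c : ℝ) (hc : 0 ≤ c) : h c = c * h 1 := by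
  have h00 : h 0 = 0 := by have := hadd 0 0 le_rfl le_rfl; simp at this; exact this
  have hn : ∀ (n : ℕ) (a : ℝ), 0 ≤ a → h (n * a) = n * h a := by
    intro n a ha
    induction n with
    | zero => simp [h00]
    | succ n ih =>
      push_cast
      rw [add_mul, one_mul, hadd _ _ (by positivity) ha, ih]; ring
  have h1 : 0 ≤ h 1 := by rw [← h00]; exact hmono 0 1 le_rfl zero_le_one
  have hb : ∀ n : ℕ, (n:ℝ) * |h c - c * h 1| ≤ h 1 := by
    intro n
    have hnc : 0 ≤ (n:ℝ) * c := by positivity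
    have l1 := Nat.floor_le hnc
    have l2 := (Nat.lt_floor_add_one ((n:ℝ) * c)).le
    have m1 := hmono _ _ (by positivity) l1
    have m2 := hmono _ _ hnc l2
    have k1 := hn ⌊(n:ℝ) * c⌋₊ 1 zero_le_one
    have k2 := hn (⌊(n:ℝ) * c⌋₊ + 1) 1 zero_le_one
    push_cast at k2
    rw [mul_one] at k1 k2
    rw [hn n c hc] at m1 m2
    rw [k1] at m1
    rw [k2] at m2
    rw [← abs_of_nonneg (Nat.cast_nonneg (α := ℝ) n), ← abs_mul, abs_le]
    constructor <;> nlinarith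
  by_contra hne
  have hpos : 0 < |h c - c * h 1| := abs_pos.2 (sub_ne_zero.2 hne)
  obtain ⟨n, hn'⟩ := exists_nat_gt (h 1 / |h c - c * h 1|)
  rw [div_lt_iff₀ hpos] at hn'
  linarith [hb n]

section Back
set_option linter.unusedSectionVars false
variable {Ω : Type*} [MeasurableSpace Ω] {P : Measure Ω} [IsProbabilityMeasure P] {N : ℕ}

/-- the tail profile -/
def psiG {N : ℕ} (G : ((Fin N → ℝ) → ℝ) → ℝ) (K : Kernel (Fin N → ℝ) ℝ) (x : ℝ) : ℝ :=
  G (fun w => 1 - (K w (Iic x)).toReal)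

lemma inDstar_tail (K : Kernel (Fin N → ℝ) ℝ) [IsMarkovKernel K] (x : ℝ) :
    InDstar (fun w => 1 - (K w (Iic x)).toReal) := by
  refine ⟨measurable_const.sub (K.measurable_coe measurableSet_Iic).ennreal_toReal, fun w => ?_⟩
  have h1 : (K w (Iic x)).toReal ≤ 1 := by
    have := ENNReal.toReal_mono ENNReal.one_ne_top (prob_le_one (μ := K w) (s := Iic x))
    simpa using this
  have h0 : 0 ≤ (K w (Iic x)).toReal := ENNReal.toReal_nonneg
  constructor <;> linarith

lemma condD_exists {X : Ω → ℝ} {W : Ω → (Fin N → ℝ)} (hX : Measurable X) (hW : Measurable W) :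
    ∃ K, IsCondDistrib P X W K := by
  refine ⟨condDistrib X W P, inferInstance, fun B hB S hS => ?_⟩
  rw [inter_comm]
  change P (W ⁻¹' S ∩ X ⁻¹' B) = _
  rw [← setLIntegral_preimage_condDistrib hW hX.aemeasurable hB hS,
    setLIntegral_map hS (Kernel.measurable_coe _ hB) hW]

lemma condD_const {W : Ω → (Fin N → ℝ)} (hW : Measurable W) (c : ℝ) :
    IsCondDistrib P (fun _ => c) W (Kernel.const _ (Measure.dirac c)) := by
  refine ⟨inferInstance, fun B hB S hS => ?_⟩
  by_cases hc : c ∈ B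
  · simp [hc, hB, Measure.map_apply hW hS]
  · simp [hc, hB]

lemma condD_cmp {X Y : Ω → ℝ} {W : Ω → (Fin N → ℝ)} {K K' : Kernel (Fin N → ℝ) ℝ}
    (hK : IsCondDistrib P X W K) (hK' : IsCondDistrib P Y W K') (hW : Measurable W) {x y : ℝ}
    (h : ∀ᵐ ω ∂P, x < X ω → y < Y ω) :
    ∀ᵐ w ∂(P.map W), K' w (Iic y) ≤ K w (Iic x) := by
  have : IsProbabilityMeasure (P.map W) := Measure.isProbabilityMeasure_map hW.aemeasurable
  refine ae_le_of_forall_setLIntegral_le_of_sigmaFinite (K'.measurable_coe measurableSet_Iic) ?_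
  intro S hS _
  rw [← hK.2 _ measurableSet_Iic S hS, ← hK'.2 _ measurableSet_Iic S hS]
  refine measure_mono_ae ?_
  filter_upwards [h] with ω hω hmem
  refine ⟨?_, hmem.2⟩
  by_contra hn
  exact absurd (hω (not_le.1 hn)) (not_lt.2 hmem.1)

lemma psi_le {X Y : Ω → ℝ} {W : Ω → (Fin N → ℝ)} {K K' : Kernel (Fin N → ℝ) ℝ}
    {G : ((Fin N → ℝ) → ℝ) → ℝ} (hG : MonotoneFunctional (P.map W) G)
    (hK : IsCondDistrib P X W K) (hK' : IsCondDistrib P Y W K') (hW : Measurable W) {x y : ℝ}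
    (h : ∀ᵐ ω ∂P, x < X ω → y < Y ω) : psiG G K x ≤ psiG G K' y := by
  have := hK.1
  have := hK'.1
  refine hG.2.2.2 _ _ (inDstar_tail K' y) (inDstar_tail K x) ?_
  filter_upwards [condD_cmp hK hK' hW h] with w hw
  have := ENNReal.toReal_mono (measure_ne_top _ _) hw
  linarith

lemma psi_anti {X : Ω → ℝ} {W : Ω → (Fin N → ℝ)} {K : Kernel (Fin N → ℝ) ℝ}
    {G : ((Fin N → ℝ) → ℝ) → ℝ} (hG : MonotoneFunctional (P.map W) G)
    (hK : IsCondDistrib P X W K) (hW : Measurable W) : Antitone (psiG G K) :=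
  fun _ _ hxy => psi_le hG hK hK hW (.of_forall fun _ h => hxy.trans_lt h)

lemma psi_const_one {W : Ω → (Fin N → ℝ)} 
    {G : ((Fin N → ℝ) → ℝ) → ℝ} (hG : MonotoneFunctional (P.map W) G) :
    psiG G (Kernel.const _ (Measure.dirac 0)) (-1) = 1 := by
  have : (fun w : Fin N → ℝ => 1 - ((Kernel.const (Fin N → ℝ) (Measure.dirac (0:ℝ))) w
      (Iic (-1))).toReal) = fun _ => 1 := by
    funext w
    simp [Measure.dirac_apply' _ measurableSet_Iic]
  rw [psiG, this, hG.2.2.1]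

lemma psi_const_zero {W : Ω → (Fin N → ℝ)} 
    {G : ((Fin N → ℝ) → ℝ) → ℝ} (hG : MonotoneFunctional (P.map W) G) :
    psiG G (Kernel.const _ (Measure.dirac 0)) 0 = 0 := by
  have : (fun w : Fin N → ℝ => 1 - ((Kernel.const (Fin N → ℝ) (Measure.dirac (0:ℝ))) w
      (Iic 0)).toReal) = fun _ => 0 := by
    funext w
    simp [Measure.dirac_apply' _ measurableSet_Iic]
  rw [psiG, this, hG.2.1]

lemma psi_one {X : Ω → ℝ} {W : Ω → (Fin N → ℝ)} {K : Kernel (Fin N → ℝ) ℝ}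
    {G : ((Fin N → ℝ) → ℝ) → ℝ} (hG : MonotoneFunctional (P.map W) G)
    (hK : IsCondDistrib P X W K) (hW : Measurable W) {x : ℝ} (h : ∀ ω, x < X ω) :
    psiG G K x = 1 := by
  have := hK.1
  refine le_antisymm (hG.1 _ (inDstar_tail K x)).2 ?_
  rw [← psi_const_one hG]
  exact psi_le hG (condD_const hW 0) hK hW (.of_forall fun ω _ => h ω)

lemma psi_zero {X : Ω → ℝ} {W : Ω → (Fin N → ℝ)} {K : Kernel (Fin N → ℝ) ℝ}
    {G : ((Fin N → ℝ) → ℝ) → ℝ} (hG : MonotoneFunctional (P.map W) G)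
    (hK : IsCondDistrib P X W K) (hW : Measurable W) {x : ℝ} (h : ∀ ω, X ω ≤ x) :
    psiG G K x = 0 := by
  have := hK.1
  refine le_antisymm ?_ (hG.1 _ (inDstar_tail K x)).1
  rw [← psi_const_zero hG]
  exact psi_le hG hK (condD_const hW 0) hW
    (.of_forall fun ω h' => absurd h' (not_lt.2 (h ω)))

lemma drm_eq {X : Ω → ℝ} {W : Ω → (Fin N → ℝ)} {K : Kernel (Fin N → ℝ) ℝ}
    {G : ((Fin N → ℝ) → ℝ) → ℝ} (hG : MonotoneFunctional (P.map W) G)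
    (hK : IsCondDistrib P X W K) (hW : Measurable W) {u v : ℝ} (huv : u ≤ v)
    (hu : ∀ ω, u ≤ X ω) (hv : ∀ ω, X ω ≤ v) :
    distortionRM G K = u + ∫ x in u..v, psiG G K x :=
  choquet_rep (psiG G K) (psi_anti hG hK hW) u v huv
    (fun _ hx => psi_one hG hK hW fun ω => hx.trans_le (hu ω))
    (fun _ hx => psi_zero hG hK hW fun ω => (hv ω).trans hx)

lemma drm_add {Z X₁ X₂ : Ω → ℝ} {f₁ f₂ : ℝ → ℝ} (hf₁ : Monotone f₁) (hf₂ : Monotone f₂)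
    (hf : ∀ x, f₁ x + f₂ x = x) (h1 : ∀ ω, X₁ ω = f₁ (Z ω)) (h2 : ∀ ω, X₂ ω = f₂ (Z ω))
    {W : Ω → (Fin N → ℝ)} {K K₁ K₂ : Kernel (Fin N → ℝ) ℝ}
    {G : ((Fin N → ℝ) → ℝ) → ℝ} (hG : MonotoneFunctional (P.map W) G)
    (hK : IsCondDistrib P Z W K) (hK₁ : IsCondDistrib P X₁ W K₁) (hK₂ : IsCondDistrib P X₂ W K₂)
    (hW : Measurable W) {a b : ℝ} (hab : a ≤ b) (ha : ∀ ω, a ≤ Z ω) (hb : ∀ ω, Z ω ≤ b) :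
    distortionRM G K = distortionRM G K₁ + distortionRM G K₂ := by
  rw [drm_eq hG hK hW hab ha hb,
    drm_eq hG hK₁ hW (hf₁ hab) (fun ω => by rw [h1]; exact hf₁ (ha ω))
      (fun ω => by rw [h1]; exact hf₁ (hb ω)),
    drm_eq hG hK₂ hW (hf₂ hab) (fun ω => by rw [h2]; exact hf₂ (ha ω))
      (fun ω => by rw [h2]; exact hf₂ (hb ω))]
  have main : ∀ (f : ℝ → ℝ) (X : Ω → ℝ) (L : Kernel (Fin N → ℝ) ℝ), Monotone f →
      (∀ ω, X ω = f (Z ω)) → IsCondDistrib P X W L → ∀ s t, a ≤ s → s ≤ t → t ≤ b →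
      (f t - f s) * psiG G K t ≤ (∫ x in f a..f t, psiG G L x) - (∫ x in f a..f s, psiG G L x) ∧
      (∫ x in f a..f t, psiG G L x) - (∫ x in f a..f s, psiG G L x) ≤
        (f t - f s) * psiG G K s := by
    intro f X L hf hX hL s t _ hst _
    have hint : ∀ s t, IntervalIntegrable (psiG G L) volume s t :=
      fun s t => (psi_anti hG hL hW).intervalIntegrable
    rw [intervalIntegral.integral_interval_sub_left (hint _ _) (hint _ _)]
    have hst' := hf hst
    rw [intervalIntegral.integral_of_le hst', integral_Ioc_eq_integral_Ioo,
      ← integral_Ico_eq_integral_Ioo]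
    have hfin : IntegrableOn (psiG G L) (Ico (f s) (f t)) := by
      have := (hint (f s) (f t)).1
      rw [integrableOn_Ioc_iff_integrableOn_Ioo] at this
      rwa [integrableOn_Ico_iff_integrableOn_Ioo]
    constructor
    · have := setIntegral_mono_on (f := fun _ => psiG G K t) (g := psiG G L)
        (s := Ico (f s) (f t)) (μ := volume) (by simp) hfin measurableSet_Ico
        (fun x hx => psi_le hG hK hL hW (.of_forall fun ω h => by
          rw [hX]; exact hx.2.trans_le (hf h.le)))
      simpa [hst'] using this
    · have := setIntegral_mono_on (g := fun _ => psiG G K s) (f := psiG G L)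
        (s := Ico (f s) (f t)) (μ := volume) hfin (by simp) measurableSet_Ico
        (fun x hx => psi_le hG hL hK hW (.of_forall fun ω h => by
          by_contra hn
          have h3 := hf (not_lt.1 hn)
          rw [hX] at h
          linarith [hx.1]))
      simpa [hst'] using this
  have := integral_of_incr (psiG G K)
    (fun t => (∫ x in f₁ a..f₁ t, psiG G K₁ x) + ∫ x in f₂ a..f₂ t, psiG G K₂ x)
    (psi_anti hG hK hW) a b hab (by
      intro s t p q r
      obtain ⟨m1, m2⟩ := main f₁ X₁ K₁ hf₁ h1 hK₁ s t p q r
      obtain ⟨m3, m4⟩ := main f₂ X₂ K₂ hf₂ h2 hK₂ s t p q r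
      have e1 := hf s
      have e2 := hf t
      have e : t - s = (f₁ t - f₁ s) + (f₂ t - f₂ s) := by linarith
      rw [e, add_mul, add_mul]
      constructor <;> linarith)
  simp only [intervalIntegral.integral_same] at this
  have := hf a
  linarith

lemma backward (ρ : (Ω → ℝ) → (Ω → (Fin N → ℝ)) → ℝ)
    (h : ∃ G : (Ω → (Fin N → ℝ)) → ((Fin N → ℝ) → ℝ) → ℝ,
      (∀ W, Measurable W → MonotoneFunctional (P.map W) (G W)) ∧
      (∀ W W', Measurable W → Measurable W' → P.map W = P.map W' → G W = G W') ∧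
      (∀ X W, BddRV X → Measurable W →
        ∀ K : Kernel (Fin N → ℝ) ℝ, IsCondDistrib P X W K →
          ρ X W = distortionRM (G W) K)) :
    ((∀ X Y W, BddRV X → BddRV Y → Measurable W → (∀ᵐ ω ∂P, X ω ≤ Y ω) → ρ X W ≤ ρ Y W) ∧
     (∀ X₁ X₂ W, BddRV X₁ → BddRV X₂ → Measurable W → Comonotonic X₁ X₂ →
        ρ (X₁ + X₂) W = ρ X₁ W + ρ X₂ W) ∧
     (∀ W, Measurable W → ρ (fun _ => 1) W = 1) ∧
     (∀ X X' W W', BddRV X → BddRV X' → Measurable W → Measurable W' →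
        (P.map fun ω => (X ω, W ω)) = (P.map fun ω => (X' ω, W' ω)) → ρ X W = ρ X' W')) := by
  obtain ⟨G, hG, hlaw, hrep⟩ := h
  refine ⟨?_, ?_, ?_, ?_⟩
  · intro X Y W hX hY hW hle
    obtain ⟨K, hK⟩ := condD_exists (P := P) hX.1 hW
    obtain ⟨K', hK'⟩ := condD_exists (P := P) hY.1 hW
    rw [hrep X W hX hW K hK, hrep Y W hY hW K' hK']
    obtain ⟨C, hC⟩ := hX.2
    obtain ⟨D, hD⟩ := hY.2
    have huv : -max |C| |D| ≤ max |C| |D| := by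
      have := (abs_nonneg C).trans (le_max_left |C| |D|)
      linarith
    have bX : ∀ ω, |X ω| ≤ max |C| |D| := fun ω =>
      ((hC ω).trans (le_abs_self C)).trans (le_max_left _ _)
    have bY : ∀ ω, |Y ω| ≤ max |C| |D| := fun ω =>
      ((hD ω).trans (le_abs_self D)).trans (le_max_right _ _)
    rw [drm_eq (hG W hW) hK hW huv (fun ω => (abs_le.1 (bX ω)).1) (fun ω => (abs_le.1 (bX ω)).2),
      drm_eq (hG W hW) hK' hW huv (fun ω => (abs_le.1 (bY ω)).1) (fun ω => (abs_le.1 (bY ω)).2)]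
    gcongr
    refine intervalIntegral.integral_mono_on huv (psi_anti (hG W hW) hK hW).intervalIntegrable
      (psi_anti (hG W hW) hK' hW).intervalIntegrable (fun x _ => ?_)
    refine psi_le (hG W hW) hK hK' hW ?_
    filter_upwards [hle] with ω hω h using h.trans_le hω
  · intro X₁ X₂ W hX₁ hX₂ hW ⟨Z, f₁, f₂, hf₁, hf₂, hf, h1, h2⟩
    have hZ : X₁ + X₂ = Z := by
      funext ω
      simp [h1, h2, hf]
    obtain ⟨C, hC⟩ := hX₁.2
    obtain ⟨D, hD⟩ := hX₂.2
    have hZb : BddRV (X₁ + X₂) := ⟨hX₁.1.add hX₂.1, C + D, fun ω =>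
      (abs_add_le _ _).trans (add_le_add (hC ω) (hD ω))⟩
    obtain ⟨K, hK⟩ := condD_exists (P := P) hZb.1 hW
    obtain ⟨K₁, hK₁⟩ := condD_exists (P := P) hX₁.1 hW
    obtain ⟨K₂, hK₂⟩ := condD_exists (P := P) hX₂.1 hW
    rw [hrep _ W hZb hW K hK, hrep _ W hX₁ hW K₁ hK₁, hrep _ W hX₂ hW K₂ hK₂]
    obtain ⟨E, hE⟩ := hZb.2
    rw [hZ] at hE hK
    exact drm_add hf₁ hf₂ hf h1 h2 (hG W hW) hK hK₁ hK₂ hW (a := -|E|) (b := |E|)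
      (by linarith [abs_nonneg E]) (fun ω => (abs_le.1 ((hE ω).trans (le_abs_self E))).1)
      (fun ω => (abs_le.1 ((hE ω).trans (le_abs_self E))).2)
  · intro W hW
    rw [hrep _ W ⟨measurable_const, 1, by simp⟩ hW _ (condD_const hW 1),
      drm_eq (hG W hW) (condD_const hW 1) hW (le_refl (1:ℝ)) (fun _ => le_rfl) (fun _ => le_rfl)]
    simp
  · intro X X' W W' hX hX' hW hW' hj
    have hWW : P.map W = P.map W' := by
      have := congrArg (Measure.map Prod.snd) hj
      rw [Measure.map_map measurable_snd (hX.1.prodMk hW),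
        Measure.map_map measurable_snd (hX'.1.prodMk hW')] at this
      exact this
    obtain ⟨K, hK⟩ := condD_exists (P := P) hX.1 hW
    have hK' : IsCondDistrib P X' W' K := by
      refine ⟨hK.1, fun B hB S hS => ?_⟩
      rw [← hWW, ← hK.2 B hB S hS]
      have := congrArg (fun m => m (B ×ˢ S)) hj
      beta_reduce at this
      rw [Measure.map_apply (hX.1.prodMk hW) (hB.prod hS),
        Measure.map_apply (hX'.1.prodMk hW') (hB.prod hS)] at this
      exact this.symm
    rw [hrep X W hX hW K hK, hrep X' W' hX' hW' K hK', hlaw W W' hW hW' hWW]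

end Back

section Fwd
set_option linter.unusedSectionVars false
variable {Ω : Type*} [MeasurableSpace Ω] {P : Measure Ω} [IsProbabilityMeasure P] {N : ℕ}

/-- `P(A | W) = f(W)` with `W` of law `μ`. -/
def CRep (P : Measure Ω) (μ : Measure (Fin N → ℝ)) (f : (Fin N → ℝ) → ℝ)
    (A : Set Ω) (W : Ω → (Fin N → ℝ)) : Prop :=
  MeasurableSet A ∧ Measurable W ∧ P.map W = μ ∧
    ∀ S, MeasurableSet S → P (A ∩ W ⁻¹' S) = ∫⁻ w in S, ENNReal.ofReal (f w) ∂μ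

/-- the indicator random variable -/
def ind (A : Set Ω) : Ω → ℝ := A.indicator (fun _ => 1)

lemma ind_bdd {A : Set Ω} (hA : MeasurableSet A) : BddRV (ind A) := by
  refine ⟨measurable_const.indicator hA, 1, fun ω => ?_⟩
  by_cases h : ω ∈ A <;> simp [ind, h]

lemma rep_law {μ : Measure (Fin N → ℝ)} {f : (Fin N → ℝ) → ℝ} {A A' : Set Ω}
    {W W' : Ω → (Fin N → ℝ)} (h : CRep P μ f A W) (h' : CRep P μ f A' W') :
    (P.map fun ω => (ind A ω, W ω)) = (P.map fun ω => (ind A' ω, W' ω)) := by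
  classical
  have m1 := (ind_bdd h.1).1.prodMk h.2.1
  have m2 := (ind_bdd h'.1).1.prodMk h'.2.1
  have : IsFiniteMeasure (P.map fun ω => (ind A ω, W ω)) := inferInstance
  refine Measure.ext_prod (fun {s t} hs ht => ?_)
  rw [Measure.map_apply m1 (hs.prod ht), Measure.map_apply m2 (hs.prod ht)]
  have e1 : P (A ∩ W ⁻¹' t) = P (A' ∩ W' ⁻¹' t) := by rw [h.2.2.2 t ht, h'.2.2.2 t ht]
  have e2 : P (W ⁻¹' t) = P (W' ⁻¹' t) := by
    rw [← Measure.map_apply h.2.1 ht, ← Measure.map_apply h'.2.1 ht, h.2.2.1, h'.2.2.1]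
  have e3 : P (W ⁻¹' t \ A) = P (W' ⁻¹' t \ A') := by
    have k1 := measure_inter_add_sdiff (μ := P) (W ⁻¹' t) h.1
    have k2 := measure_inter_add_sdiff (μ := P) (W' ⁻¹' t) h'.1
    rw [inter_comm] at k1 k2
    rw [← e2, ← k1, e1] at k2
    exact ((ENNReal.add_right_inj (measure_ne_top _ _)).1 k2).symm
  have key : ∀ (A : Set Ω) (W : Ω → (Fin N → ℝ)),
      ((fun ω => (ind A ω, W ω)) ⁻¹' s ×ˢ t) =
        if (1:ℝ) ∈ s then (if (0:ℝ) ∈ s then W ⁻¹' t else A ∩ W ⁻¹' t)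
        else (if (0:ℝ) ∈ s then W ⁻¹' t \ A else ∅) := by
    intro A W
    ext ω
    by_cases h1 : (1:ℝ) ∈ s <;> by_cases h0 : (0:ℝ) ∈ s <;> by_cases hA : ω ∈ A <;>
      simp [ind, h1, h0, hA]
  rw [key, key]
  split_ifs <;> simp [e1, e2, e3]

lemma rep_exists (hat : Atomless P) (μ : Measure (Fin N → ℝ)) [IsProbabilityMeasure μ]
    {f g : (Fin N → ℝ) → ℝ} (hf : InDstar f) (hg : InDstar g) (hgf : ∀ᵐ w ∂μ, g w ≤ f w) :
    ∃ A B W, CRep P μ f A W ∧ CRep P μ g B W ∧ (∀ᵐ ω ∂P, ω ∈ B → ω ∈ A) := by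
  obtain ⟨U, hU, hUlaw⟩ := exists_unif hat
  obtain ⟨T, hT, hTlaw⟩ :=
    (μ.prod (volume : Measure unitInterval)).exists_measurable_map_eq
  let Q : Ω → (Fin N → ℝ) × unitInterval := fun ω => T (U ω)
  have hQ : Measurable Q := hT.comp hU
  have hQlaw : P.map Q = μ.prod volume := by
    rw [← hTlaw, ← hUlaw, Measure.map_map hT hU]; rfl
  have hWlaw : P.map (fun ω => (Q ω).1) = μ := by
    have : P.map (fun ω => (Q ω).1) = (P.map Q).map Prod.fst := by
      rw [Measure.map_map measurable_fst hQ]; rfl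
    rw [this, hQlaw]
    simp
  have hset : ∀ f : (Fin N → ℝ) → ℝ, Measurable f →
      MeasurableSet {q : (Fin N → ℝ) × unitInterval | (q.2 : ℝ) ≤ f q.1} := fun f hf =>
    measurableSet_le (measurable_subtype_coe.comp measurable_snd) (hf.comp measurable_fst)
  have hrep : ∀ f : (Fin N → ℝ) → ℝ, InDstar f →
      CRep P μ f (Q ⁻¹' {q | (q.2 : ℝ) ≤ f q.1}) (fun ω => (Q ω).1) := by
    intro f hf
    refine ⟨hQ (hset f hf.1), measurable_fst.comp hQ, hWlaw, fun S hS => ?_⟩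
    have e : (Q ⁻¹' {q | (q.2 : ℝ) ≤ f q.1}) ∩ (fun ω => (Q ω).1) ⁻¹' S =
        Q ⁻¹' ({q | (q.2 : ℝ) ≤ f q.1} ∩ Prod.fst ⁻¹' S) := rfl
    rw [e, ← Measure.map_apply hQ ((hset f hf.1).inter (measurable_fst hS)), hQlaw,
      Measure.prod_apply ((hset f hf.1).inter (measurable_fst hS)), ← lintegral_indicator hS]
    refine lintegral_congr (fun w => ?_)
    by_cases hw : w ∈ S
    · have : Prod.mk w ⁻¹' ({q : (Fin N → ℝ) × unitInterval | (q.2 : ℝ) ≤ f q.1} ∩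
          Prod.fst ⁻¹' S) = Iic (⟨f w, hf.2 w⟩ : unitInterval) := by
        ext u
        simp [hw, ← Subtype.coe_le_coe]
      rw [this, unitInterval.volume_Iic]
      simp [hw]
    · have : Prod.mk w ⁻¹' ({q : (Fin N → ℝ) × unitInterval | (q.2 : ℝ) ≤ f q.1} ∩
          Prod.fst ⁻¹' S) = ∅ := by
        ext u
        simp [hw]
      rw [this]
      simp [hw]
  refine ⟨_, _, _, hrep f hf, hrep g hg, ?_⟩
  rw [← hWlaw] at hgf
  have := ae_of_ae_map (measurable_fst.comp hQ).aemeasurable hgf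
  filter_upwards [this] with ω hω hB
  have hB' : ((Q ω).2 : ℝ) ≤ g (Q ω).1 := hB
  exact hB'.trans hω

lemma rho_lin {R : (Ω → ℝ) → ℝ}
    (hM : ∀ X Y, BddRV X → BddRV Y → (∀ᵐ ω ∂P, X ω ≤ Y ω) → R X ≤ R Y)
    (hCA : ∀ X₁ X₂, BddRV X₁ → BddRV X₂ → Comonotonic X₁ X₂ → R (X₁ + X₂) = R X₁ + R X₂)
    {X : Ω → ℝ} (hX : BddRV X) (hX0 : ∀ ω, 0 ≤ X ω) {c : ℝ} (hc : 0 ≤ c) :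
    R (fun ω => c * X ω) = c * R X := by
  have hb : ∀ a : ℝ, BddRV (fun ω => a * X ω) := by
    intro a
    obtain ⟨C, hC⟩ := hX.2
    refine ⟨measurable_const.mul hX.1, |a| * C, fun ω => ?_⟩
    rw [abs_mul]
    exact mul_le_mul_of_nonneg_left (hC ω) (abs_nonneg a)
  have := additive_mono_linear (fun c => R (fun ω => c * X ω)) ?_ ?_ c hc
  · simpa using this
  · intro a b ha hb'
    have e : (fun ω => (a + b) * X ω) = (fun ω => a * X ω) + (fun ω => b * X ω) := by
      funext ω; simp [add_mul]
    rw [e]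
    refine hCA _ _ (hb a) (hb b) ?_
    rcases eq_or_lt_of_le (add_nonneg ha hb') with h0 | h0
    · have ha0 : a = 0 := by linarith
      have hb0 : b = 0 := by linarith
      refine ⟨fun _ => 0, fun x => x / 2, fun x => x / 2, ?_, ?_, ?_, ?_, ?_⟩
      · intro x y h; simp only; linarith
      · intro x y h; simp only; linarith
      · intro x; ring
      · intro ω; simp [ha0]
      · intro ω; simp [hb0]
    · refine ⟨fun ω => (a + b) * X ω, fun x => a / (a + b) * x, fun x => b / (a + b) * x,
        ?_, ?_, ?_, ?_, ?_⟩
      · intro x y h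
        exact mul_le_mul_of_nonneg_left h (div_nonneg ha h0.le)
      · intro x y h
        exact mul_le_mul_of_nonneg_left h (div_nonneg hb' h0.le)
      · intro x; field_simp
      · intro ω; field_simp
      · intro ω; field_simp
  · intro a b _ hab
    exact hM _ _ (hb a) (hb b) (.of_forall fun ω => mul_le_mul_of_nonneg_right hab (hX0 ω))

lemma rho_choquet {R : (Ω → ℝ) → ℝ}
    (hM : ∀ X Y, BddRV X → BddRV Y → (∀ᵐ ω ∂P, X ω ≤ Y ω) → R X ≤ R Y)
    (hCA : ∀ X₁ X₂, BddRV X₁ → BddRV X₂ → Comonotonic X₁ X₂ → R (X₁ + X₂) = R X₁ + R X₂)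
    (hN : R (fun _ => 1) = 1)
    {X : Ω → ℝ} (hX : BddRV X) {u v : ℝ} (huv : u ≤ v)
    (hu : ∀ ω, u ≤ X ω) (hv : ∀ ω, X ω ≤ v) :
    R X = u + ∫ x in u..v, R (ind {ω | x < X ω}) := by
  have bc : ∀ c : ℝ, BddRV (fun _ : Ω => c) := fun c => ⟨measurable_const, |c|, fun _ => le_rfl⟩
  have hpos : ∀ c : ℝ, 0 ≤ c → R (fun _ => c) = c := by
    intro c hc
    have := rho_lin hM hCA (bc 1) (fun _ => zero_le_one) hc
    simpa [hN] using this
  have hneg : ∀ c : ℝ, 0 ≤ c → R (fun _ => -c) = -c := by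
    intro c hc
    have h1 := hCA _ _ (bc (-c)) (bc c) ⟨fun _ => 0, fun x => x / 2 - c, fun x => x / 2 + c,
      (by intro x y h; simp only; linarith), (by intro x y h; simp only; linarith),
      (by intro x; ring), (by intro ω; simp), (by intro ω; simp)⟩
    have e : ((fun _ => -c) + fun _ => c : Ω → ℝ) = fun _ => 0 := by funext ω; simp
    rw [e, hpos 0 le_rfl, hpos c hc] at h1
    linarith
  have hconst : ∀ c : ℝ, R (fun _ => c) = c := by
    intro c
    rcases le_total 0 c with h | h
    · exact hpos c h
    · have := hneg (-c) (by linarith)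
      simpa using this
  have hms : ∀ x, MeasurableSet {ω | x < X ω} := fun x => measurableSet_lt measurable_const hX.1
  have hanti : Antitone (fun x => R (ind {ω | x < X ω})) := by
    intro x y hxy
    refine hM _ _ (ind_bdd (hms y)) (ind_bdd (hms x)) (.of_forall fun ω => ?_)
    refine indicator_le_indicator_of_subset ?_ (fun _ => zero_le_one) ω
    intro ω h
    exact lt_of_le_of_lt hxy h
  have hbmin : ∀ t, BddRV (fun ω => min (X ω) t) := by
    intro t
    obtain ⟨C, hC⟩ := hX.2
    refine ⟨hX.1.min measurable_const, max C |t|, fun ω => ?_⟩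
    exact abs_min_le_max_abs_abs.trans (max_le_max (hC ω) le_rfl)
  have := integral_of_incr (fun x => R (ind {ω | x < X ω})) (fun t => R (fun ω => min (X ω) t))
    hanti u v huv (by
      intro s t _ hst _
      have hbd : BddRV (fun ω => max (min (X ω) t - s) 0) := by
        refine ⟨((hX.1.min measurable_const).sub measurable_const).max measurable_const, |t - s|,
          fun ω => ?_⟩
        rw [abs_of_nonneg (le_max_right _ _)]
        refine max_le ?_ (abs_nonneg _)
        exact (sub_le_sub_right (min_le_right _ _) s).trans (le_abs_self _)
      have hdec : R (fun ω => min (X ω) t) =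
          R (fun ω => min (X ω) s) + R (fun ω => max (min (X ω) t - s) 0) := by
        rw [← hCA _ _ (hbmin s) hbd]
        · congr 1
          funext ω
          simp only [Pi.add_apply]
          rcases le_total (X ω) s with h1 | h1
          · rw [min_eq_left h1, min_eq_left (h1.trans hst), max_eq_right (by linarith)]; ring
          · rw [min_eq_right h1, max_eq_left (by linarith [le_min h1 hst])]; ring
        · refine ⟨fun ω => min (X ω) t, fun x => min x s, fun x => max (x - s) 0, ?_, ?_, ?_, ?_, ?_⟩
          · intro x y h; exact min_le_min h le_rfl
          · intro x y h; exact max_le_max (by linarith) le_rfl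
          · intro x
            beta_reduce
            rcases le_total x s with h1 | h1
            · rw [min_eq_left h1, max_eq_right (by linarith)]; ring
            · rw [min_eq_right h1, max_eq_left (by linarith)]; ring
          · intro ω
            simp only
            rw [min_assoc, min_eq_right hst]
          · intro ω; rfl
      rw [hdec, add_sub_cancel_left]
      have hb' : ∀ x, BddRV (fun ω => (t - s) * ind {ω | x < X ω} ω) := by
        intro x
        obtain ⟨C, hC⟩ := (ind_bdd (hms x)).2
        refine ⟨measurable_const.mul (ind_bdd (hms x)).1, |t - s| * C, fun ω => ?_⟩
        rw [abs_mul]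
        exact mul_le_mul_of_nonneg_left (hC ω) (abs_nonneg _)
      have hi0 : ∀ x ω, 0 ≤ ind {ω | x < X ω} ω := fun x ω =>
        indicator_nonneg (fun _ _ => zero_le_one) ω
      have hts : 0 ≤ t - s := by linarith
      constructor
      · rw [← rho_lin hM hCA (ind_bdd (hms t)) (hi0 t) hts]
        refine hM _ _ (hb' t) hbd (.of_forall fun ω => ?_)
        by_cases h : t < X ω
        · simp [ind, h, min_eq_right h.le]
        · simp [ind, h]
      · rw [← rho_lin hM hCA (ind_bdd (hms s)) (hi0 s) hts]
        refine hM _ _ hbd (hb' s) (.of_forall fun ω => ?_)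
        by_cases h : s < X ω
        · simp [ind, h, hst]
        · simp [ind, h]
          left; exact not_lt.1 h)
  beta_reduce at this
  have e1 : (fun ω => min (X ω) u) = fun _ => u := by funext ω; exact min_eq_right (hu ω)
  have e2 : (fun ω => min (X ω) v) = X := by funext ω; exact min_eq_left (hv ω)
  rw [e1, e2, hconst] at this
  linarith

lemma forward (hat : Atomless P) (ρ : (Ω → ℝ) → (Ω → (Fin N → ℝ)) → ℝ)
    (hM : ∀ X Y W, BddRV X → BddRV Y → Measurable W → (∀ᵐ ω ∂P, X ω ≤ Y ω) → ρ X W ≤ ρ Y W)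
    (hCA : ∀ X₁ X₂ W, BddRV X₁ → BddRV X₂ → Measurable W → Comonotonic X₁ X₂ →
        ρ (X₁ + X₂) W = ρ X₁ W + ρ X₂ W)
    (hN : ∀ W, Measurable W → ρ (fun _ => 1) W = 1)
    (hLI : ∀ X X' W W', BddRV X → BddRV X' → Measurable W → Measurable W' →
        (P.map fun ω => (X ω, W ω)) = (P.map fun ω => (X' ω, W' ω)) → ρ X W = ρ X' W') :
    ∃ G : (Ω → (Fin N → ℝ)) → ((Fin N → ℝ) → ℝ) → ℝ,
      (∀ W, Measurable W → MonotoneFunctional (P.map W) (G W)) ∧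
      (∀ W W', Measurable W → Measurable W' → P.map W = P.map W' → G W = G W') ∧
      (∀ X W, BddRV X → Measurable W →
        ∀ K : Kernel (Fin N → ℝ) ℝ, IsCondDistrib P X W K →
          ρ X W = distortionRM (G W) K) := by
  classical
  let H : Measure (Fin N → ℝ) → ((Fin N → ℝ) → ℝ) → ℝ := fun μ f =>
    if h : ∃ p : Set Ω × (Ω → (Fin N → ℝ)), CRep P μ f p.1 p.2 then
      ρ (ind h.choose.1) h.choose.2 else 0
  have hH : ∀ μ f A W, CRep P μ f A W → H μ f = ρ (ind A) W := by
    intro μ f A W hr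
    have hex : ∃ p : Set Ω × (Ω → (Fin N → ℝ)), CRep P μ f p.1 p.2 := ⟨(A, W), hr⟩
    have hs := hex.choose_spec
    simp only [H, dif_pos hex]
    exact hLI _ _ _ _ (ind_bdd hs.1) (ind_bdd hr.1) hs.2.1 hr.2.1 (rep_law hs hr)
  have hzero : ∀ W, Measurable W → ρ (fun _ => 0) W = 0 := by
    intro W hW
    have := rho_lin (R := fun X => ρ X W) (fun X Y a b c => hM X Y W a b hW c)
      (fun X Y a b c => hCA X Y W a b hW c) (X := fun _ => 1) ⟨measurable_const, 1, by simp⟩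
      (fun _ => zero_le_one) (le_refl (0:ℝ))
    simpa using this
  have hmono : ∀ W, Measurable W → MonotoneFunctional (P.map W) (H (P.map W)) := by
    intro W hW
    have : IsProbabilityMeasure (P.map W) := Measure.isProbabilityMeasure_map hW.aemeasurable
    have r0 : CRep P (P.map W) (fun _ => 0) ∅ W := ⟨.empty, hW, rfl, by simp⟩
    have r1 : CRep P (P.map W) (fun _ => 1) univ W :=
      ⟨.univ, hW, rfl, fun S hS => by simp [Measure.map_apply hW hS]⟩
    have e0 : H (P.map W) (fun _ => 0) = 0 := by
      rw [hH _ _ _ _ r0]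
      have : (ind ∅ : Ω → ℝ) = fun _ => 0 := by funext ω; simp [ind]
      rw [this, hzero W hW]
    have e1 : H (P.map W) (fun _ => 1) = 1 := by
      rw [hH _ _ _ _ r1]
      have : (ind univ : Ω → ℝ) = fun _ => 1 := by funext ω; simp [ind]
      rw [this, hN W hW]
    have hm : ∀ f g, InDstar f → InDstar g → (∀ᵐ w ∂(P.map W), g w ≤ f w) →
        H (P.map W) g ≤ H (P.map W) f := by
      intro f g hf hg hgf
      obtain ⟨A, B, W', hA, hB, hBA⟩ := rep_exists hat (P.map W) hf hg hgf
      rw [hH _ _ _ _ hA, hH _ _ _ _ hB]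
      refine hM _ _ _ (ind_bdd hB.1) (ind_bdd hA.1) hA.2.1 ?_
      filter_upwards [hBA] with ω hω
      by_cases h : ω ∈ B
      · simp [ind, h, hω h]
      · simp only [ind, h, not_false_eq_true, indicator_of_notMem]
        exact indicator_nonneg (fun _ _ => zero_le_one) ω
    have d0 : InDstar (fun _ : Fin N → ℝ => (0:ℝ)) := ⟨measurable_const, fun _ => by simp⟩
    have d1 : InDstar (fun _ : Fin N → ℝ => (1:ℝ)) := ⟨measurable_const, fun _ => by simp⟩
    refine ⟨fun f hf => ⟨?_, ?_⟩, e0, e1, hm⟩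
    · rw [← e0]; exact hm _ _ hf d0 (.of_forall fun w => (hf.2 w).1)
    · rw [← e1]; exact hm _ _ d1 hf (.of_forall fun w => (hf.2 w).2)
  refine ⟨fun W => H (P.map W), hmono, fun W W' _ _ h => by simp only [h], ?_⟩
  intro X W hX hW K hK
  have := hK.1
  obtain ⟨C, hC⟩ := hX.2
  have hb : ∀ ω, |X ω| ≤ |C| := fun ω => (hC ω).trans (le_abs_self C)
  have huv : -|C| ≤ |C| := by linarith [abs_nonneg C]
  rw [drm_eq (hmono W hW) hK hW huv (fun ω => (abs_le.1 (hb ω)).1) (fun ω => (abs_le.1 (hb ω)).2),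
    rho_choquet (R := fun X => ρ X W) (fun X Y a b c => hM X Y W a b hW c)
      (fun X Y a b c => hCA X Y W a b hW c) (hN W hW) hX huv
      (fun ω => (abs_le.1 (hb ω)).1) (fun ω => (abs_le.1 (hb ω)).2)]
  congr 1
  refine intervalIntegral.integral_congr (fun x _ => ?_)
  refine (hH _ _ {ω | x < X ω} W ⟨measurableSet_lt measurable_const hX.1, hW, rfl, ?_⟩).symm
  intro S hS
  have e1 : {ω | x < X ω} ∩ W ⁻¹' S = {ω | X ω ∈ Ioi x} ∩ W ⁻¹' S := rfl
  rw [e1, hK.2 _ measurableSet_Ioi S hS]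
  refine lintegral_congr (fun w => ?_)
  rw [← compl_Iic, prob_compl_eq_one_sub measurableSet_Iic,
    ENNReal.ofReal_sub _ ENNReal.toReal_nonneg, ENNReal.ofReal_toReal (measure_ne_top _ _)]
  simp

end Fwd

/-- **Theorem (distortion factor risk measures).** A mapping `ρ : 𝒳 × 𝒴 → ℝ` satisfies
M, CA, N and LI iff it is represented by a law-invariant family of monotone functionals
`{G_W}` as a Choquet-type integral of the conditional distribution functions. -/
theorem stmt2 {Ω : Type*} [MeasurableSpace Ω] (P : Measure Ω) [IsProbabilityMeasure P]
    (hatomless : Atomless P) {N : ℕ} (hN : 1 ≤ N)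
    (ρ : (Ω → ℝ) → (Ω → (Fin N → ℝ)) → ℝ) :
    ((∀ X Y W, BddRV X → BddRV Y → Measurable W → (∀ᵐ ω ∂P, X ω ≤ Y ω) → ρ X W ≤ ρ Y W) ∧
     (∀ X₁ X₂ W, BddRV X₁ → BddRV X₂ → Measurable W → Comonotonic X₁ X₂ →
        ρ (X₁ + X₂) W = ρ X₁ W + ρ X₂ W) ∧
     (∀ W, Measurable W → ρ (fun _ => 1) W = 1) ∧
     (∀ X X' W W', BddRV X → BddRV X' → Measurable W → Measurable W' →
        (P.map fun ω => (X ω, W ω)) = (P.map fun ω => (X' ω, W' ω)) → ρ X W = ρ X' W'))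
    ↔
    ∃ G : (Ω → (Fin N → ℝ)) → ((Fin N → ℝ) → ℝ) → ℝ,
      (∀ W, Measurable W → MonotoneFunctional (P.map W) (G W)) ∧
      (∀ W W', Measurable W → Measurable W' → P.map W = P.map W' → G W = G W') ∧
      (∀ X W, BddRV X → Measurable W →
        ∀ K : Kernel (Fin N → ℝ) ℝ, IsCondDistrib P X W K →
          ρ X W = distortionRM (G W) K) := by
  exact ⟨fun h => forward hatomless ρ h.1 h.2.1 h.2.2.1 h.2.2.2, fun h => backward ρ h⟩
end
end

section
/- Let {G_W : W ∈ 𝒴} be a family of monotone functionals and let ρ_{G_W}(X, W) = ∫₀^∞ G_W(1 − F_{X|W=·}(x)) dx + ∫_{−∞}^0 (G_W(1 − F_{X|W=·}(x)) − 1) dx be the associated distortion factor risk measure. Then ρ_{G_W} is law-invariant (ρ_{G_W}(X, W) = ρ_{G_{W'}}(X', W') whenever (X, W) and (X', W') are equal in joint distribution) if and only if {G_W : W ∈ 𝒴} is weakly law-invariant, i.e., for all A, A' ∈ 𝓕 and W, W' ∈ 𝒴 with (1_A, W) equal in joint distribution to (1_{A'}, W'), one has G_W(ℙ(A | W = ·))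 = G_{W'}(ℙ(A' | W' = ·)). -/
open MeasureTheory ProbabilityTheory Set Filter

noncomputable section

/-- `f` is a Borel measurable version of the conditional probability `P(A | W = ·)`. -/
def IsCondProb {Ω : Type*} [MeasurableSpace Ω] {N : ℕ} (P : Measure Ω)
    (A : Set Ω) (W : Ω → (Fin N → ℝ)) (f : (Fin N → ℝ) → ℝ) : Prop :=
  InDstar f ∧ ∀ S : Set (Fin N → ℝ), MeasurableSet S →
    (P (A ∩ W ⁻¹' S)).toReal = ∫ w in S, f w ∂(P.map W)

def bernK {N : ℕ} (f : (Fin N → ℝ) → ℝ) (hf : Measurable f) : Kernel (Fin N → ℝ) ℝ where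
  toFun w := ENNReal.ofReal (f w) • Measure.dirac 1 + ENNReal.ofReal (1 - f w) • Measure.dirac 0
  measurable' := by
    refine Measure.measurable_of_measurable_coe _ fun s hs => ?_
    simp only [Measure.add_apply, Measure.smul_apply, smul_eq_mul]
    fun_prop

lemma bernK_apply {N : ℕ} (f : (Fin N → ℝ) → ℝ) (hf : Measurable f) (w : Fin N → ℝ) (s : Set ℝ)
    (hs : MeasurableSet s) : bernK f hf w s =
      ENNReal.ofReal (f w) * s.indicator 1 1 + ENNReal.ofReal (1 - f w) * s.indicator 1 0 := by
  change (ENNReal.ofReal (f w) • Measure.dirac (1:ℝ) +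
    ENNReal.ofReal (1 - f w) • Measure.dirac (0:ℝ) : Measure ℝ) s = _
  simp only [Measure.add_apply, Measure.smul_apply, smul_eq_mul, Measure.dirac_apply' _ hs]

lemma bernK_sum {N : ℕ} (f : (Fin N → ℝ) → ℝ) (h : InDstar f) (w : Fin N → ℝ) :
    ENNReal.ofReal (f w) + ENNReal.ofReal (1 - f w) = 1 := by
  rw [← ENNReal.ofReal_add (h.2 w).1 (by linarith [(h.2 w).2])]
  simp

lemma bernK_cond {Ω : Type*} [MeasurableSpace Ω] (P : Measure Ω) [IsProbabilityMeasure P] {N : ℕ}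
    (A : Set Ω) (hA : MeasurableSet A) (W : Ω → (Fin N → ℝ)) (hW : Measurable W)
    (f : (Fin N → ℝ) → ℝ) (h : IsCondProb P A W f) :
    IsCondDistrib P (A.indicator (fun _ => (1:ℝ))) W (bernK f h.1.1) := by
  haveI : IsProbabilityMeasure (P.map W) := Measure.isProbabilityMeasure_map hW.aemeasurable
  have hf := h.1.1
  refine ⟨⟨fun w => ⟨?_⟩⟩, fun B hB S hS => ?_⟩
  · rw [bernK_apply _ _ _ _ MeasurableSet.univ]
    simpa using bernK_sum f h.1 w
  have hint : Integrable f (P.map W) := by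
    refine Integrable.of_bound hf.aestronglyMeasurable 1 (Eventually.of_forall fun w => ?_)
    rw [Real.norm_eq_abs, abs_of_nonneg (h.1.2 w).1]
    exact (h.1.2 w).2
  have e1 : ∫⁻ w in S, ENNReal.ofReal (f w) ∂(P.map W) = P (A ∩ W ⁻¹' S) := by
    rw [← ofReal_integral_eq_lintegral_ofReal hint.integrableOn
      (Eventually.of_forall fun w => (h.1.2 w).1), ← h.2 S hS, ENNReal.ofReal_toReal]
    exact measure_ne_top _ _
  have e3 : P (A ∩ W ⁻¹' S) + P (Aᶜ ∩ W ⁻¹' S) = P (W ⁻¹' S) := by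
    rw [inter_comm, inter_comm Aᶜ, ← diff_eq]
    exact measure_inter_add_diff _ hA
  have e4 : ∫⁻ w in S, ENNReal.ofReal (f w) ∂(P.map W)
      + ∫⁻ w in S, ENNReal.ofReal (1 - f w) ∂(P.map W) = P (W ⁻¹' S) := by
    rw [← lintegral_add_left (by fun_prop)]
    simp_rw [bernK_sum f h.1]
    simp [Measure.map_apply hW hS]
  have e2 : ∫⁻ w in S, ENNReal.ofReal (1 - f w) ∂(P.map W) = P (Aᶜ ∩ W ⁻¹' S) := by
    rw [← e3, e1] at e4
    exact (ENNReal.add_right_inj (measure_ne_top _ _)).1 e4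
  simp_rw [bernK_apply _ _ _ _ hB]
  by_cases h1 : (1:ℝ) ∈ B <;> by_cases h0 : (0:ℝ) ∈ B
  · have : {ω | A.indicator (fun _ => (1:ℝ)) ω ∈ B} = univ := by
      ext ω; by_cases ha : ω ∈ A <;> simp [ha, h1, h0]
    simp only [this, h1, h0, indicator_of_mem, Pi.one_apply, mul_one, univ_inter]
    rw [lintegral_add_left (by fun_prop), e4]
  · have : {ω | A.indicator (fun _ => (1:ℝ)) ω ∈ B} = A := by
      ext ω; by_cases ha : ω ∈ A <;> simp [ha, h1, h0]
    simp [this, h1, h0, e1]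
  · have : {ω | A.indicator (fun _ => (1:ℝ)) ω ∈ B} = Aᶜ := by
      ext ω; by_cases ha : ω ∈ A <;> simp [ha, h1, h0]
    simp [this, h1, h0, e2]
  · have : {ω | A.indicator (fun _ => (1:ℝ)) ω ∈ B} = ∅ := by
      ext ω; by_cases ha : ω ∈ A <;> simp [ha, h1, h0]
    simp [this, h1, h0]

lemma bernK_rm {N : ℕ} (μ : Measure (Fin N → ℝ)) (G : ((Fin N → ℝ) → ℝ) → ℝ)
    (hG : MonotoneFunctional μ G) (f : (Fin N → ℝ) → ℝ) (h : InDstar f) :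
    distortionRM G (bernK f h.1) = G f := by
  unfold distortionRM
  have a1 : ∀ x ∈ Ioi (0:ℝ), G (fun w => 1 - (bernK f h.1 w (Iic x)).toReal)
      = (Iio (1:ℝ)).indicator (fun _ => G f) x := by
    intro x hx
    have hx' : (0:ℝ) ≤ x := le_of_lt hx
    by_cases h1 : x < 1
    · rw [indicator_of_mem (by exact h1)]
      congr 1
      funext w
      rw [bernK_apply _ _ _ _ measurableSet_Iic]
      have := (h.2 w).2
      simp [hx', not_le.2 h1, ENNReal.toReal_ofReal, this]
    · rw [indicator_of_notMem (by exact h1)]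
      refine Eq.trans (congrArg G ?_) hG.2.1
      funext w
      rw [bernK_apply _ _ _ _ measurableSet_Iic]
      simp [hx', not_lt.1 h1, bernK_sum f h w]
  have a2 : ∀ x ∈ Iio (0:ℝ), G (fun w => 1 - (bernK f h.1 w (Iic x)).toReal) - 1 = 0 := by
    intro x hx
    have hx' : x < 0 := hx
    rw [sub_eq_zero]
    refine Eq.trans (congrArg G ?_) hG.2.2.1
    funext w
    rw [bernK_apply _ _ _ _ measurableSet_Iic]
    simp [hx', hx'.trans one_pos]
  rw [setIntegral_congr_fun measurableSet_Ioi a1, setIntegral_congr_fun measurableSet_Iio a2,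
    setIntegral_indicator measurableSet_Iio]
  simp [Ioi_inter_Iio]

lemma condProb_of_condDistrib {Ω : Type*} [MeasurableSpace Ω] (P : Measure Ω)
    [IsProbabilityMeasure P] {N : ℕ} (X : Ω → ℝ) (W : Ω → (Fin N → ℝ)) (hW : Measurable W)
    (K : Kernel (Fin N → ℝ) ℝ) (h : IsCondDistrib P X W K) (x : ℝ) :
    IsCondProb P (X ⁻¹' Ioi x) W (fun w => 1 - (K w (Iic x)).toReal) := by
  haveI := h.1
  haveI : IsProbabilityMeasure (P.map W) := Measure.isProbabilityMeasure_map hW.aemeasurable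
  have e : ∀ w, 1 - (K w (Iic x)).toReal = (K w (Ioi x)).toReal := by
    intro w
    have := probReal_compl_eq_one_sub (μ := K w) (measurableSet_Iic (a := x))
    rw [compl_Iic] at this
    exact this.symm
  simp_rw [e]
  have hm : Measurable fun w => K w (Ioi x) := K.measurable_coe measurableSet_Ioi
  refine ⟨⟨hm.ennreal_toReal, fun w => ⟨ENNReal.toReal_nonneg, measureReal_le_one⟩⟩,
    fun S hS => ?_⟩
  rw [integral_toReal hm.aemeasurable (Eventually.of_forall fun w => measure_lt_top _ _),
    ← h.2 _ measurableSet_Ioi S hS]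
  rfl

/-- **Proposition (weak law-invariance characterizes law-invariance of distortion factor
risk measures).** -/
theorem stmt3 {Ω : Type*} [MeasurableSpace Ω] (P : Measure Ω) [IsProbabilityMeasure P]
    (hatomless : Atomless P) {N : ℕ} (hN : 1 ≤ N)
    (G : (Ω → (Fin N → ℝ)) → ((Fin N → ℝ) → ℝ) → ℝ)
    (hG : ∀ W : Ω → (Fin N → ℝ), Measurable W → MonotoneFunctional (P.map W) (G W)) :
    -- law-invariance of `ρ_{G_W}`
    (∀ (X X' : Ω → ℝ) (W W' : Ω → (Fin N → ℝ)),
      BddRV X → BddRV X' → Measurable W → Measurable W' →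
      (P.map fun ω => (X ω, W ω)) = (P.map fun ω => (X' ω, W' ω)) →
      ∀ K K' : Kernel (Fin N → ℝ) ℝ, IsCondDistrib P X W K → IsCondDistrib P X' W' K' →
        distortionRM (G W) K = distortionRM (G W') K')
    ↔
    -- weak law-invariance of `{G_W}`
    (∀ (A A' : Set Ω) (W W' : Ω → (Fin N → ℝ)),
      MeasurableSet A → MeasurableSet A' → Measurable W → Measurable W' →
      (P.map fun ω => (A.indicator (fun _ => (1:ℝ)) ω, W ω)) =
        (P.map fun ω => (A'.indicator (fun _ => (1:ℝ)) ω, W' ω)) →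
      ∀ f f' : (Fin N → ℝ) → ℝ, IsCondProb P A W f → IsCondProb P A' W' f' →
        G W f = G W' f') := by
  constructor
  · intro h A A' W W' hA hA' hW hW' hl f f' hf hf'
    have b : ∀ A : Set Ω, MeasurableSet A → BddRV (A.indicator (fun _ => (1:ℝ))) := by
      intro A hA
      refine ⟨measurable_const.indicator hA, 1, fun ω => ?_⟩
      by_cases ha : ω ∈ A <;> simp [ha]
    have := h _ _ W W' (b A hA) (b A' hA') hW hW' hl _ _ (bernK_cond P A hA W hW f hf)
      (bernK_cond P A' hA' W' hW' f' hf')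
    rwa [bernK_rm _ _ (hG W hW) f hf.1, bernK_rm _ _ (hG W' hW') f' hf'.1] at this
  · intro h X X' W W' hX hX' hW hW' hl K K' hK hK'
    have key : ∀ x : ℝ, G W (fun w => 1 - (K w (Iic x)).toReal)
        = G W' (fun w => 1 - (K' w (Iic x)).toReal) := by
      intro x
      refine h _ _ W W' (hX.1 measurableSet_Ioi) (hX'.1 measurableSet_Ioi) hW hW' ?_ _ _
        (condProb_of_condDistrib P X W hW K hK x) (condProb_of_condDistrib P X' W' hW' K' hK' x)
      have hg : Measurable fun p : ℝ × (Fin N → ℝ) =>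
          ((Ioi x).indicator (fun _ => (1:ℝ)) p.1, p.2) :=
        ((measurable_const.indicator measurableSet_Ioi).comp measurable_fst).prodMk measurable_snd
      have := congrArg (Measure.map fun p : ℝ × (Fin N → ℝ) =>
          ((Ioi x).indicator (fun _ => (1:ℝ)) p.1, p.2)) hl
      rw [Measure.map_map hg (hX.1.prodMk hW), Measure.map_map hg (hX'.1.prodMk hW')] at this
      exact this
    unfold distortionRM
    simp_rw [key]
end
end
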